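/- (Acyclic order.) Assume in addition that p is a rooted tree with root r and depth bound N (p r = r and p^[N] g = r for every g). Define the delivery-precedence relation ≺ on M by: m ≺ m' iff there exists g ∈ D m ∩ D m' with ord g m m'. Then ≺ is acyclic: its transitive closure is irreflexive, i.e., there is no finite cycle m₀ ≺ m₁ ≺ ⋯ ≺ mₙ ≺ m₀ (formally, ¬ Relation.TransGen (· ≺ ·) m m for every m : M). -/

import Mathlib

/-- The ancestor relation: `a` is an ancestor of `b` iff some iterate of the
parent function maps `b` to `a`. -/
def anc {G : Type*} (p : G → G) (a b : G) : Prop := ∃ k : ℕ, p^[k] b = a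

/-- The ordering path of a message `m`: the groups lying on a downward path
from the least common ancestor `L m` to some destination of `m`. -/
def orderPath {G M : Type*} (p : G → G) (D : M → Set G) (L : M → G) (m : M) : Set G :=
  {g : G | anc p (L m) g ∧ ∃ x ∈ D m, anc p g x}

section Overlay

variable {G M : Type*} {p : G → G} {D : M → Set G} {L : M → G} {ord : G → M → M → Prop}

theorem anc.trans {a b c : G} (hab : anc p a b) (hbc : anc p b c) : anc p a c := by
  obtain ⟨i, rfl⟩ := hab
  obtain ⟨j, rfl⟩ := hbc
  exact ⟨i + j, Function.iterate_add_apply p i j c⟩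

theorem anc_total_of_common_descendant {a b g : G} (ha : anc p a g) (hb : anc p b g) :
    anc p a b ∨ anc p b a := by
  obtain ⟨i, rfl⟩ := ha
  obtain ⟨j, rfl⟩ := hb
  rcases le_total i j with h | h
  · exact .inr ⟨j - i, by rw [← Function.iterate_add_apply, Nat.sub_add_cancel h]⟩
  · exact .inl ⟨i - j, by rw [← Function.iterate_add_apply, Nat.sub_add_cancel h]⟩

/-- In a rooted tree there is a depth function that increases strictly along proper descent. -/
theorem exists_depth {r : G} {N : ℕ} (hroot : p r = r) (hdepth : ∀ g, p^[N] g = r) :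
    ∃ d : G → ℕ, ∀ a b, anc p a b → a = b ∨ d a < d b := by
  classical
  have hex : ∀ g, ∃ k, p^[k] g = r := fun g => ⟨N, hdepth g⟩
  refine ⟨fun g => Nat.find (hex g), ?_⟩
  have hstep : ∀ g, p g = g ∨ Nat.find (hex (p g)) < Nat.find (hex g) := by
    intro g
    have hg := Nat.find_spec (hex g)
    rcases hk : Nat.find (hex g) with _ | k
    · rw [hk] at hg
      obtain rfl : g = r := hg
      exact .inl hroot
    · rw [hk, Function.iterate_succ_apply] at hg
      exact .inr (Nat.lt_succ_of_le (Nat.find_min' _ hg))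
  rintro a b ⟨k, hk⟩
  induction k generalizing b with
  | zero => exact .inl hk.symm
  | succ k ih =>
    rcases hstep b with hb | hb
    · exact ih b (by rwa [Function.iterate_succ_apply, hb] at hk)
    · rcases ih (p b) hk with rfl | h
      · exact .inr hb
      · exact .inr (h.trans hb)

theorem mem_orderPath_of_mem (hL : ∀ m, ∀ g ∈ D m, anc p (L m) g) {m : M} {g : G}
    (hg : g ∈ D m) : g ∈ orderPath p D L m :=
  ⟨hL m g hg, g, hg, 0, rfl⟩

theorem mem_orderPath_of_anc {m : M} {a g : G} (hg : g ∈ orderPath p D L m)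
    (hLa : anc p (L m) a) (hag : anc p a g) : a ∈ orderPath p D L m :=
  ⟨hLa, hg.2.imp fun _ hx => ⟨hx.1, hag.trans hx.2⟩⟩

/-- Local consistency along tree edges propagates along ancestor chains. -/
theorem ord_iff_of_anc
    (hloc : ∀ g h : G, p h = g → ∀ m m' : M,
      g ∈ orderPath p D L m ∩ orderPath p D L m' →
      h ∈ orderPath p D L m ∩ orderPath p D L m' → (ord g m m' ↔ ord h m m'))
    {m m' : M} {a g : G} (hag : anc p a g)
    (ha : a ∈ orderPath p D L m ∩ orderPath p D L m')
    (hg : g ∈ orderPath p D L m ∩ orderPath p D L m') :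
    ord a m m' ↔ ord g m m' := by
  obtain ⟨k, hk⟩ := hag
  induction k generalizing g with
  | zero => obtain rfl : g = a := hk; rfl
  | succ k ih =>
    have hap : anc p a (p g) := ⟨k, hk⟩
    have hpg : p g ∈ orderPath p D L m ∩ orderPath p D L m' :=
      ⟨mem_orderPath_of_anc hg.1 (ha.1.1.trans hap) ⟨1, rfl⟩,
        mem_orderPath_of_anc hg.2 (ha.2.1.trans hap) ⟨1, rfl⟩⟩
    exact (ih hpg hk).trans (hloc _ _ rfl m m' hpg hg)

/-- `m` is ordered before `m'` at some group lying on both ordering paths. -/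
def PathPrec (p : G → G) (D : M → Set G) (L : M → G) (ord : G → M → M → Prop)
    (m m' : M) : Prop :=
  ∃ g ∈ orderPath p D L m ∩ orderPath p D L m', ord g m m'

/-- `m` is ordered before `m'` at `L m'`, which lies on both ordering paths. -/
def DownPrec (p : G → G) (D : M → Set G) (L : M → G) (ord : G → M → M → Prop)
    (m m' : M) : Prop :=
  L m' ∈ orderPath p D L m ∩ orderPath p D L m' ∧ ord (L m') m m'

theorem PathPrec.downPrec
    (hloc : ∀ g h : G, p h = g → ∀ m m' : M,
      g ∈ orderPath p D L m ∩ orderPath p D L m' →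
      h ∈ orderPath p D L m ∩ orderPath p D L m' → (ord g m m' ↔ ord h m m'))
    {m m' : M} (h : PathPrec p D L ord m m') (hanc : anc p (L m) (L m')) :
    DownPrec p D L ord m m' := by
  obtain ⟨g, hg, ho⟩ := h
  have hmem : L m' ∈ orderPath p D L m ∩ orderPath p D L m' :=
    ⟨mem_orderPath_of_anc hg.1 hanc hg.2.1, mem_orderPath_of_anc hg.2 ⟨0, rfl⟩ hg.2.1⟩
  exact ⟨hmem, (ord_iff_of_anc hloc hg.2.1 hmem hg).2 ho⟩

theorem PathPrec.anc_total {m m' : M} (h : PathPrec p D L ord m m') :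
    anc p (L m) (L m') ∨ anc p (L m') (L m) :=
  let ⟨_, hg, _⟩ := h
  anc_total_of_common_descendant hg.1.1 hg.2.1

/-- Removing a message that lies weakly below both its neighbours. -/
theorem DownPrec.trans_pathPrec
    (htrans : ∀ g : G, ∀ m₁ m₂ m₃ : M, ord g m₁ m₂ → ord g m₂ m₃ → ord g m₁ m₃)
    (hloc : ∀ g h : G, p h = g → ∀ m m' : M,
      g ∈ orderPath p D L m ∩ orderPath p D L m' →
      h ∈ orderPath p D L m ∩ orderPath p D L m' → (ord g m m' ↔ ord h m m'))
    {m₁ m₂ m₃ : M} (h₁₂ : DownPrec p D L ord m₁ m₂) (h₂₃ : PathPrec p D L ord m₂ m₃)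
    (hanc : anc p (L m₃) (L m₂)) : PathPrec p D L ord m₁ m₃ := by
  obtain ⟨g, hg, ho⟩ := h₂₃
  have hmem : L m₂ ∈ orderPath p D L m₃ := mem_orderPath_of_anc hg.2 hanc hg.1.1
  exact ⟨L m₂, ⟨h₁₂.1.1, hmem⟩, htrans _ _ _ _ h₁₂.2
    ((ord_iff_of_anc hloc hg.1.1 ⟨h₁₂.1.2, hmem⟩ hg).2 ho)⟩

theorem transGen_downPrec_tail
    (htrans : ∀ g : G, ∀ m₁ m₂ m₃ : M, ord g m₁ m₂ → ord g m₂ m₃ → ord g m₁ m₃)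
    (hloc : ∀ g h : G, p h = g → ∀ m m' : M,
      g ∈ orderPath p D L m ∩ orderPath p D L m' →
      h ∈ orderPath p D L m ∩ orderPath p D L m' → (ord g m m' ↔ ord h m m'))
    {a b c : M} (hab : Relation.TransGen (DownPrec p D L ord) a b)
    (hbc : PathPrec p D L ord b c) (hmin : anc p (L c) (L a) → anc p (L a) (L c)) :
    Relation.TransGen (DownPrec p D L ord) a c := by
  induction hab with
  | single hab =>
    rcases hbc.anc_total with h | h
    · exact .tail (.single hab) (hbc.downPrec hloc h)
    · have hac := hab.trans_pathPrec htrans hloc hbc h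
      exact .single (hac.downPrec hloc (hac.anc_total.elim id hmin))
  | tail hab hb ih =>
    rcases hbc.anc_total with h | h
    · exact .tail (.tail hab hb) (hbc.downPrec hloc h)
    · exact ih (hb.trans_pathPrec htrans hloc hbc h)

theorem transGen_downPrec_ord
    (htrans : ∀ g : G, ∀ m₁ m₂ m₃ : M, ord g m₁ m₂ → ord g m₂ m₃ → ord g m₁ m₃)
    (hantisymm : ∀ a b, anc p a b → anc p b a → a = b)
    {a b : M} (hab : Relation.TransGen (DownPrec p D L ord) a b) :
    anc p (L a) (L b) ∧ (L b = L a → ord (L a) a b) := by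
  induction hab with
  | single h => exact ⟨h.1.1.1, fun e => e ▸ h.2⟩
  | @tail b c _ hbc ih =>
    refine ⟨ih.1.trans hbc.1.1.1, fun e => ?_⟩
    have hb : L b = L a := hantisymm _ _ (e ▸ hbc.1.1.1) ih.1
    exact htrans _ _ _ _ (ih.2 hb) (e ▸ hbc.2)

theorem not_transGen_pathPrec_self {r : G} {N : ℕ} (hroot : p r = r)
    (hdepth : ∀ g, p^[N] g = r) (hirr : ∀ g : G, ∀ m : M, ¬ ord g m m)
    (htrans : ∀ g : G, ∀ m₁ m₂ m₃ : M, ord g m₁ m₂ → ord g m₂ m₃ → ord g m₁ m₃)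
    (hloc : ∀ g h : G, p h = g → ∀ m m' : M,
      g ∈ orderPath p D L m ∩ orderPath p D L m' →
      h ∈ orderPath p D L m ∩ orderPath p D L m' → (ord g m m' ↔ ord h m m'))
    (m : M) : ¬ Relation.TransGen (PathPrec p D L ord) m m := by
  obtain ⟨d, hd⟩ := exists_depth hroot hdepth
  have hantisymm : ∀ a b, anc p a b → anc p b a → a = b := by
    intro a b hab hba
    rcases hd a b hab with h | h
    · exact h
    · rcases hd b a hba with h' | h'
      · exact h'.symm
      · omega
  induction hn : d (L m) using Nat.strong_induction_on generalizing m with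
  | _ n ih =>
  subst hn
  intro hm
  have hmin : ∀ b, Relation.TransGen (PathPrec p D L ord) b b →
      anc p (L b) (L m) → anc p (L m) (L b) := by
    intro b hb hanc
    rcases hd _ _ hanc with h | h
    · exact ⟨0, h⟩
    · exact absurd hb (ih _ h b rfl)
  have key : ∀ b, Relation.TransGen (PathPrec p D L ord) m b →
      Relation.TransGen (PathPrec p D L ord) b m →
      Relation.TransGen (DownPrec p D L ord) m b := by
    intro b hmb
    induction hmb with
    | single h =>
      intro hbm
      exact .single (h.downPrec hloc (h.anc_total.elim id (hmin _ (hbm.tail h))))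
    | tail hmb hbc ihb =>
      intro hcm
      exact transGen_downPrec_tail htrans hloc (ihb (.head hbc hcm)) hbc
        (hmin _ (hcm.trans (hmb.tail hbc)))
  exact hirr _ _ ((transGen_downPrec_ord htrans hantisymm (key m hm hm)).2 rfl)

end Overlay

/-- Acyclic order: for a rooted tree overlay, the delivery-precedence relation
`m ≺ m' iff some common destination group orders m before m'` is acyclic. -/
theorem acyclic_order {G M : Type*} (p : G → G) (r : G) (N : ℕ)
    (hroot : p r = r) (hdepth : ∀ g : G, p^[N] g = r)
    (D : M → Set G) (L : M → G)
    (hL : ∀ m : M, ∀ g ∈ D m, anc p (L m) g)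
    (ord : G → M → M → Prop)
    (hirr : ∀ g : G, ∀ m : M, ¬ ord g m m)
    (htrans : ∀ g : G, ∀ m₁ m₂ m₃ : M, ord g m₁ m₂ → ord g m₂ m₃ → ord g m₁ m₃)
    (hloc : ∀ g h : G, p h = g → ∀ m m' : M,
      g ∈ orderPath p D L m ∩ orderPath p D L m' →
      h ∈ orderPath p D L m ∩ orderPath p D L m' →
      (ord g m m' ↔ ord h m m'))
    (m : M) :
    ¬ Relation.TransGen (fun m₁ m₂ : M => ∃ g ∈ D m₁ ∩ D m₂, ord g m₁ m₂) m m := by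
  intro h
  refine not_transGen_pathPrec_self (D := D) (L := L) hroot hdepth hirr htrans hloc m
    (Relation.TransGen.mono ?_ m m h)
  rintro a b ⟨g, hg, ho⟩
  exact ⟨g, ⟨mem_orderPath_of_mem hL hg.1, mem_orderPath_of_mem hL hg.2⟩, ho⟩
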